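/- Let c be odd, k > 1, and n >= (c+1)^3 + (c+1). Then Player 2 has a winning strategy in the two-player (c,k)-nacci Zeckendorf game on n, but there exists a legal move for Player 2 on turn c+1 after which Player 1 has a winning strategy for the remainder of the game. -/

import Mathlib

/-- The `(c,k)`-nacci numbers: `nacci c k 1 = 1`,
`nacci c k (i+1) = c * (nacci c k i + ⋯ + nacci c k 1) + 1` for `1 ≤ i ≤ k`, and
`nacci c k (i+1) = c * (nacci c k i + ⋯ + nacci c k (i-k))` for `i ≥ k + 1`.
(The value at `0` is junk.) -/
def nacci (c k : ℕ) : ℕ → ℕ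
  | 0 => 0
  | 1 => 1
  | (i + 2) =>
    if i + 1 ≤ k then
      c * ((Finset.range (i + 1)).attach.sum fun j => nacci c k (j.1 + 1)) + 1
    else
      c * ((Finset.Icc (i + 1 - k) (i + 1)).attach.sum fun j => nacci c k j.1)
decreasing_by
  · have hj := j.2
    simp only [Finset.mem_range] at hj
    omega
  · have hj := j.2
    simp only [Finset.mem_Icc] at hj
    omega


/-- The multiset consisting of `c` copies of `nacci c k j` for each `j` in the
finite set `s`. -/
def nacciBlock (c k : ℕ) (s : Finset ℕ) : Multiset ℕ :=
  s.val.bind fun j => Multiset.replicate c (nacci c k j)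

/-- A legal move of the `(c,k)`-nacci Zeckendorf game, as a relation between the
position before and the position after the move (positions are multisets of naturals). -/
def CkMove (c k : ℕ) (A B : Multiset ℕ) : Prop :=
  -- (1) for `i ≥ k+1`: `c` copies each of `S_{i-k}, …, S_i` become `S_{i+1}`
  (∃ i, k + 1 ≤ i ∧ nacciBlock c k (Finset.Icc (i - k) i) ≤ A ∧
    B = A - nacciBlock c k (Finset.Icc (i - k) i) + {nacci c k (i + 1)}) ∨
  -- (2) for `2 ≤ i ≤ k`: `c+1` copies of `S_1` and `c` copies each of `S_2, …, S_i`
  -- become `S_{i+1}`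
  (∃ i, 2 ≤ i ∧ i ≤ k ∧
    Multiset.replicate (c + 1) (nacci c k 1) + nacciBlock c k (Finset.Icc 2 i) ≤ A ∧
    B = A - (Multiset.replicate (c + 1) (nacci c k 1) + nacciBlock c k (Finset.Icc 2 i))
        + {nacci c k (i + 1)}) ∨
  -- (3) `c+1` copies of `S_1` become `S_2`
  (Multiset.replicate (c + 1) (nacci c k 1) ≤ A ∧
    B = A - Multiset.replicate (c + 1) (nacci c k 1) + {nacci c k 2}) ∨
  -- (3) for `1 < i < k+1`: `c+1` copies of `S_i` become `S_{i+1}`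
  (∃ i, 1 < i ∧ i < k + 1 ∧ Multiset.replicate (c + 1) (nacci c k i) ≤ A ∧
    B = A - Multiset.replicate (c + 1) (nacci c k i) + {nacci c k (i + 1)}) ∨
  -- (3) `c+1` copies of `S_{k+1}` become `S_{k+2}` and `S_1`
  (Multiset.replicate (c + 1) (nacci c k (k + 1)) ≤ A ∧
    B = A - Multiset.replicate (c + 1) (nacci c k (k + 1))
        + {nacci c k (k + 2), nacci c k 1}) ∨
  -- (3) for `i > k+1`: `c+1` copies of `S_i` become `S_{i+1}` and `c` copies of `S_{i-k-1}`
  (∃ i, k + 1 < i ∧ Multiset.replicate (c + 1) (nacci c k i) ≤ A ∧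
    B = A - Multiset.replicate (c + 1) (nacci c k i)
        + ({nacci c k (i + 1)} + Multiset.replicate c (nacci c k (i - k - 1))))

/-- A position is terminal when no legal move remains. -/
def Terminal (Move : Multiset ℕ → Multiset ℕ → Prop) (pos : Multiset ℕ) : Prop :=
  ∀ B, ¬ Move pos B

/-- `AllianceWins Move p team t pos`: in the `p`-player game with move relation `Move`,
where players `1, …, p` move cyclically (the mover of the `t`-th move, counting from `t = 0`,
is player `t % p + 1`) and the side making the last legal move wins, the alliance
(set of players) `team` can guarantee, from position `pos` with `t` moves already made,
that one of its members makes the last move, no matter how the other players play. -/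
inductive AllianceWins (Move : Multiset ℕ → Multiset ℕ → Prop) (p : ℕ) (team : ℕ → Prop) :
    ℕ → Multiset ℕ → Prop
  | endMove (t : ℕ) (pos B : Multiset ℕ) (hturn : team (t % p + 1)) (hmove : Move pos B)
      (hterm : Terminal Move B) : AllianceWins Move p team t pos
  | contMove (t : ℕ) (pos B : Multiset ℕ) (hturn : team (t % p + 1)) (hmove : Move pos B)
      (hwin : AllianceWins Move p team (t + 1) B) : AllianceWins Move p team t pos
  | oppMove (t : ℕ) (pos : Multiset ℕ) (hturn : ¬ team (t % p + 1))
      (hex : ∃ B, Move pos B)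
      (hall : ∀ B, Move pos B → AllianceWins Move p team (t + 1) B) :
      AllianceWins Move p team t pos

/-- Player `m` has a winning strategy in the `p`-player game on `n`
(played from `n` copies of `1`, with player 1 moving first). -/
def PlayerWins (Move : Multiset ℕ → Multiset ℕ → Prop) (p m n : ℕ) : Prop :=
  AllianceWins Move p (fun q => q = m) 0 (Multiset.replicate n 1)

namespace CkGame

/-- Recursion for the nacci numbers without `attach`. -/
theorem nacci_succ_succ (c k i : ℕ) : nacci c k (i + 2) =
    if i + 1 ≤ k then c * (∑ j ∈ Finset.range (i + 1), nacci c k (j + 1)) + 1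
    else c * (∑ j ∈ Finset.Icc (i + 1 - k) (i + 1), nacci c k j) := by
  rw [nacci]
  rw [Finset.sum_attach (Finset.range (i + 1)) (fun j => nacci c k (j + 1)),
    Finset.sum_attach (Finset.Icc (i + 1 - k) (i + 1)) (fun j => nacci c k j)]

theorem nacci_zero (c k : ℕ) : nacci c k 0 = 0 := by rw [nacci]
theorem nacci_one (c k : ℕ) : nacci c k 1 = 1 := by rw [nacci]

theorem nacci_pos (c k : ℕ) (hc : 1 ≤ c) (i : ℕ) : 1 ≤ nacci c k (i + 1) := by
  induction i with
  | zero => rw [nacci_one]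
  | succ i ih =>
    rw [nacci_succ_succ]
    split_ifs with h
    · omega
    · have h1 : nacci c k (i + 1) ≤ ∑ j ∈ Finset.Icc (i + 1 - k) (i + 1), nacci c k j :=
        Finset.single_le_sum (f := fun j => nacci c k j) (fun _ _ => Nat.zero_le _)
          (by simp)
      nlinarith

theorem nacci_lt (c k : ℕ) (hc : 1 ≤ c) (hk : 1 < k) (i : ℕ) :
    nacci c k i < nacci c k (i + 1) := by
  rcases i with _ | i
  · rw [nacci_zero, nacci_one]; omega
  rw [nacci_succ_succ]
  split_ifs with h
  · have h1 : nacci c k (i + 1) ≤ ∑ j ∈ Finset.range (i + 1), nacci c k (j + 1) :=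
      Finset.single_le_sum (f := fun j => nacci c k (j + 1)) (fun _ _ => Nat.zero_le _)
        (by simp)
    nlinarith
  · obtain ⟨i, rfl⟩ : ∃ i', i = i' + 1 := ⟨i - 1, by omega⟩
    have h1 : ∑ j ∈ ({i + 1, i + 1 + 1} : Finset ℕ), nacci c k j
        ≤ ∑ j ∈ Finset.Icc (i + 1 + 1 - k) (i + 1 + 1), nacci c k j := by
      apply Finset.sum_le_sum_of_subset
      intro x hx
      simp only [Finset.mem_insert, Finset.mem_singleton] at hx
      simp only [Finset.mem_Icc]
      omega
    rw [Finset.sum_pair (by omega)] at h1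
    have := nacci_pos c k hc i
    nlinarith

theorem nacci_inj (c k : ℕ) (hc : 1 ≤ c) (hk : 1 < k) : Function.Injective (nacci c k) :=
  (strictMono_nat_of_lt_succ (nacci_lt c k hc hk)).injective

/-! ### Termination -/

/-- Weight of a position. -/
noncomputable def wt (c k : ℕ) (A : Multiset ℕ) : ℕ :=
  (A.map fun x => Function.invFun (nacci c k) x + 1).sum

theorem wt_add (c k : ℕ) (A B : Multiset ℕ) : wt c k (A + B) = wt c k A + wt c k B := by
  simp [wt]

theorem wt_single (c k : ℕ) (hc : 1 ≤ c) (hk : 1 < k) (i : ℕ) :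
    wt c k {nacci c k i} = i + 1 := by
  simp [wt, Function.leftInverse_invFun (nacci_inj c k hc hk) i]

theorem wt_rep (c k : ℕ) (hc : 1 ≤ c) (hk : 1 < k) (i r : ℕ) :
    wt c k (Multiset.replicate r (nacci c k i)) = r * (i + 1) := by
  simp [wt, Function.leftInverse_invFun (nacci_inj c k hc hk) i]

theorem wt_block (c k : ℕ) (hc : 1 ≤ c) (hk : 1 < k) (s : Finset ℕ) :
    wt c k (nacciBlock c k s) = ∑ j ∈ s, c * (j + 1) := by
  classical
  induction s using Finset.induction_on with
  | empty => simp [wt, nacciBlock]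
  | insert a s ha ih =>
    rw [Finset.sum_insert ha, ← ih, ← wt_rep c k hc hk, ← wt_add]
    congr 1
    simp [nacciBlock, Finset.insert_val_of_notMem ha]

theorem wt_step (c k : ℕ) {A R N : Multiset ℕ} (h : R ≤ A) (hw : wt c k N < wt c k R) :
    wt c k (A - R + N) < wt c k A := by
  have h1 : wt c k A = wt c k (A - R) + wt c k R := by
    rw [← wt_add, tsub_add_cancel_of_le h]
  rw [wt_add]; omega

theorem wt_move (c k : ℕ) (hc : 1 ≤ c) (hk : 1 < k) {A B : Multiset ℕ}
    (h : CkMove c k A B) : wt c k B < wt c k A := by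
  rcases h with ⟨i, hi, hR, rfl⟩ | ⟨i, hi, hik, hR, rfl⟩ | ⟨hR, rfl⟩ | ⟨i, hi, hik, hR, rfl⟩ |
    ⟨hR, rfl⟩ | ⟨i, hi, hR, rfl⟩
  all_goals apply wt_step c k hR
  · rw [wt_single c k hc hk, wt_block c k hc hk]
    obtain ⟨i, rfl⟩ : ∃ i', i = i' + 1 := ⟨i - 1, by omega⟩
    have h1 : ∑ j ∈ ({i, i + 1} : Finset ℕ), c * (j + 1)
        ≤ ∑ j ∈ Finset.Icc (i + 1 - k) (i + 1), c * (j + 1) := by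
      apply Finset.sum_le_sum_of_subset
      intro x hx
      simp only [Finset.mem_insert, Finset.mem_singleton] at hx
      simp only [Finset.mem_Icc]
      omega
    rw [Finset.sum_pair (by omega)] at h1
    nlinarith
  · rw [wt_single c k hc hk, wt_add, wt_rep c k hc hk, wt_block c k hc hk]
    have h1 : c * (i + 1) ≤ ∑ j ∈ Finset.Icc 2 i, c * (j + 1) :=
      Finset.single_le_sum (f := fun j => c * (j + 1)) (fun _ _ => Nat.zero_le _)
        (by simp; omega)
    nlinarith
  · rw [wt_single c k hc hk, wt_rep c k hc hk]
    nlinarith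
  · rw [wt_single c k hc hk, wt_rep c k hc hk]
    nlinarith
  · rw [Multiset.insert_eq_cons, ← Multiset.singleton_add, wt_add, wt_single c k hc hk,
      wt_single c k hc hk, wt_rep c k hc hk]
    nlinarith
  · rw [wt_add, wt_single c k hc hk, wt_rep c k hc hk, wt_rep c k hc hk]
    obtain ⟨j, rfl⟩ : ∃ j, i = j + k + 1 := ⟨i - k - 1, by omega⟩
    have : j + k + 1 - k - 1 = j := by omega
    rw [this]
    nlinarith

/-! ### Outcome classes -/

/-- `Out M true A`: the player to move wins from `A`; `Out M false A`: the player to move loses. -/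
inductive Out (M : Multiset ℕ → Multiset ℕ → Prop) : Bool → Multiset ℕ → Prop
  | win (A B : Multiset ℕ) (h : M A B) (hB : Out M false B) : Out M true A
  | lose (A : Multiset ℕ) (h : ∀ B, M A B → Out M true B) : Out M false A

theorem Out.alliance {M : Multiset ℕ → Multiset ℕ → Prop} {m : ℕ} (hm : m = 1 ∨ m = 2)
    {b : Bool} {A : Multiset ℕ} (h : Out M b A) : ∀ t : ℕ,
    (b = true → t % 2 + 1 = m → AllianceWins M 2 (fun q => q = m) t A) ∧
    (b = false → t % 2 + 1 ≠ m → Terminal M A ∨ AllianceWins M 2 (fun q => q = m) t A) := by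
  induction h with
  | win A B h hB ih =>
    intro t
    refine ⟨fun _ ht => ?_, fun h => by simp at h⟩
    rcases (ih (t + 1)).2 rfl (by omega) with h1 | h1
    · exact .endMove t A B ht h h1
    · exact .contMove t A B ht h h1
  | lose A h ih =>
    intro t
    refine ⟨fun h => by simp at h, fun _ ht => ?_⟩
    by_cases hex : ∃ B, M A B
    · right
      exact .oppMove t A ht hex fun B hB => (ih B hB (t + 1)).1 rfl (by omega)
    · left
      intro B hB
      exact hex ⟨B, hB⟩

theorem out_total (c k : ℕ) (hc : 1 ≤ c) (hk : 1 < k) : ∀ (N : ℕ) (A : Multiset ℕ),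
    wt c k A = N → Out (CkMove c k) true A ∨ Out (CkMove c k) false A := by
  intro N
  induction N using Nat.strong_induction_on with
  | _ N ih =>
    intro A hA
    by_cases h : ∃ B, CkMove c k A B ∧ Out (CkMove c k) false B
    · obtain ⟨B, h1, h2⟩ := h
      exact Or.inl (.win A B h1 h2)
    · right
      refine .lose A fun B hB => ?_
      rcases ih _ (hA ▸ wt_move c k hc hk hB) B rfl with h1 | h1
      · exact h1
      · exact absurd ⟨B, hB, h1⟩ h

/-! ### Positions using only the first four numbers -/

/-- `a` copies of `S_1`, `b` of `S_2`, `d` of `S_3`, `e` of `S_4`. -/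
def pos (c k a b d e : ℕ) : Multiset ℕ :=
  Multiset.replicate a (nacci c k 1) + Multiset.replicate b (nacci c k 2) +
    Multiset.replicate d (nacci c k 3) + Multiset.replicate e (nacci c k 4)

/-- The extra `S_1` obtained when `k = 2`. -/
def dl (k : ℕ) : ℕ := if k = 2 then 1 else 0

theorem move_eq {A R N A' B' : Multiset ℕ} (hA : A = R + A') (hB : B' = A' + N) :
    R ≤ A ∧ B' = A - R + N := by
  subst hA hB
  exact ⟨Multiset.le_add_right _ _, by rw [add_tsub_cancel_left]⟩

theorem pos_add (c k a b d e a' b' d' e' : ℕ) :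
    pos c k (a + a') (b + b') (d + d') (e + e') = pos c k a b d e + pos c k a' b' d' e' := by
  simp only [pos, Multiset.replicate_add]
  abel

theorem rep1 (c k r : ℕ) : Multiset.replicate r (nacci c k 1) = pos c k r 0 0 0 := by simp [pos]
theorem rep2 (c k r : ℕ) : Multiset.replicate r (nacci c k 2) = pos c k 0 r 0 0 := by simp [pos]
theorem rep3 (c k r : ℕ) : Multiset.replicate r (nacci c k 3) = pos c k 0 0 r 0 := by simp [pos]
theorem sing2 (c k : ℕ) : {nacci c k 2} = pos c k 0 1 0 0 := by simp [pos]
theorem sing3 (c k : ℕ) : {nacci c k 3} = pos c k 0 0 1 0 := by simp [pos]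
theorem sing4 (c k : ℕ) : {nacci c k 4} = pos c k 0 0 0 1 := by simp [pos]
theorem sing41 (c k : ℕ) : {nacci c k 4, nacci c k 1} = pos c k 1 0 0 1 := by
  simp only [pos, Multiset.insert_eq_cons, ← Multiset.singleton_add]
  simp only [Multiset.replicate_one, Multiset.replicate_zero]
  abel

theorem block22 (c k : ℕ) : nacciBlock c k (Finset.Icc 2 2) = pos c k 0 c 0 0 := by
  simp [nacciBlock, pos]

theorem block23 (c k : ℕ) : nacciBlock c k (Finset.Icc 2 3) = pos c k 0 c c 0 := by
  have : Finset.Icc 2 3 = ({2, 3} : Finset ℕ) := by decide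
  rw [this]
  simp [nacciBlock, pos, Finset.insert_val_of_notMem]

theorem block13 (c k : ℕ) : nacciBlock c k (Finset.Icc 1 3) = pos c k c c c 0 := by
  have : Finset.Icc 1 3 = ({1, 2, 3} : Finset ℕ) := by decide
  rw [this]
  simp [nacciBlock, pos, Finset.insert_val_of_notMem, add_assoc]

theorem pos_congr {c k a b d e a' b' d' e' : ℕ} (h1 : a = a') (h2 : b = b') (h3 : d = d')
    (h4 : e = e') : pos c k a b d e = pos c k a' b' d' e' := by subst h1 h2 h3 h4; rfl

theorem move_one (c k a b d e : ℕ) :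
    CkMove c k (pos c k (a + (c + 1)) b d e) (pos c k a (b + 1) d e) := by
  right; right; left
  apply move_eq (A' := pos c k a b d e)
  · rw [rep1, ← pos_add]; apply pos_congr <;> omega
  · rw [sing2, ← pos_add]; apply pos_congr <;> omega

theorem move_two (c k a b d e : ℕ) (hk : 1 < k) :
    CkMove c k (pos c k (a + (c + 1)) (b + c) d e) (pos c k a b (d + 1) e) := by
  right; left
  refine ⟨2, le_rfl, hk, ?_⟩
  apply move_eq (A' := pos c k a b d e)
  · rw [rep1, block22, ← pos_add, ← pos_add]; apply pos_congr <;> omega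
  · rw [sing3, ← pos_add]; apply pos_congr <;> omega

theorem move_three (c k a b d e : ℕ) (hk : 1 < k) :
    CkMove c k (pos c k a b (d + (c + 1)) e) (pos c k (a + dl k) b d (e + 1)) := by
  right; right; right
  by_cases h : k = 2
  · subst h
    right; left
    apply move_eq (A' := pos c 2 a b d e)
    · rw [rep3, ← pos_add]; apply pos_congr <;> omega
    · rw [sing41, ← pos_add]; apply pos_congr <;> simp [dl]
  · left
    refine ⟨3, by omega, by omega, ?_⟩
    apply move_eq (A' := pos c k a b d e)
    · rw [rep3, ← pos_add]; apply pos_congr <;> omega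
    · rw [sing4, ← pos_add]; apply pos_congr <;> simp [dl, h]

theorem move_big (c k a b d e : ℕ) (hk : 1 < k) :
    CkMove c k (pos c k (a + (c + 1)) (b + c) (d + c) e) (pos c k (a + dl k) b d (e + 1)) := by
  by_cases h : k = 2
  · subst h
    left
    refine ⟨3, le_rfl, ?_⟩
    apply move_eq (A' := pos c 2 (a + 1) b d e)
    · rw [block13, ← pos_add]; apply pos_congr <;> omega
    · rw [sing4, ← pos_add]; apply pos_congr <;> simp [dl]
  · right; left
    refine ⟨3, by omega, by omega, ?_⟩
    apply move_eq (A' := pos c k a b d e)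
    · rw [rep1, block23, ← pos_add, ← pos_add]; apply pos_congr <;> omega
    · rw [sing4, ← pos_add]; apply pos_congr <;> simp [dl, h]

/-- Multiplicity of the `j`-th number. -/
theorem count_pos (c k : ℕ) (hc : 1 ≤ c) (hk : 1 < k) (a b d e j : ℕ) :
    (pos c k a b d e).count (nacci c k j) =
      if j = 1 then a else if j = 2 then b else if j = 3 then d else if j = 4 then e else 0 := by
  have h := nacci_inj c k hc hk
  simp only [pos, Multiset.count_add, Multiset.count_replicate, h.eq_iff]
  split_ifs <;> omega

theorem count_of_rep {c k r j : ℕ} {A : Multiset ℕ}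
    (h : Multiset.replicate r (nacci c k j) ≤ A) : r ≤ A.count (nacci c k j) :=
  Multiset.le_count_iff_replicate_le.mpr h

theorem count_of_block {c k j : ℕ} {s : Finset ℕ} {A : Multiset ℕ} (hj : j ∈ s)
    (h : nacciBlock c k s ≤ A) : c ≤ A.count (nacci c k j) := by
  apply count_of_rep
  refine le_trans ?_ h
  exact Multiset.le_bind (f := fun j => Multiset.replicate c (nacci c k j)) s.val hj

theorem move_inv (c k : ℕ) (hc : 1 ≤ c) (hk : 1 < k) {a b d e : ℕ} {B : Multiset ℕ}
    (hb : b < c) (he : e ≤ c) (h : CkMove c k (pos c k a b d e) B) :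
    (∃ a', a = a' + (c + 1) ∧ B = pos c k a' (b + 1) d e) ∨
    (∃ d', d = d' + (c + 1) ∧ B = pos c k (a + dl k) b d' (e + 1)) := by
  rcases h with ⟨i, hi, hR, rfl⟩ | ⟨i, hi, hik, hR, rfl⟩ | ⟨hR, rfl⟩ | ⟨i, hi, hik, hR, rfl⟩ |
    ⟨hR, rfl⟩ | ⟨i, hi, hR, rfl⟩
  · exfalso
    have h0 := count_of_block (j := i) (by simp) hR
    have h1 := count_of_block (j := i - 1) (by simp; omega) hR
    have h2 := count_of_block (j := i - 2) (by simp; omega) hR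
    rw [count_pos c k hc hk] at h0 h1 h2
    split_ifs at h0 h1 h2 <;> omega
  · exfalso
    have h1 := count_of_block (j := 2) (by simp; omega)
      (le_trans (Multiset.le_add_left _ _) hR)
    rw [count_pos c k hc hk] at h1
    simp at h1
    omega
  · left
    have h1 := count_of_rep hR
    rw [count_pos c k hc hk] at h1
    simp only [if_true] at h1
    obtain ⟨a', rfl⟩ : ∃ a', a = a' + (c + 1) := ⟨a - (c + 1), by omega⟩
    refine ⟨a', rfl, Eq.symm (move_eq (A' := pos c k a' b d e) ?_ ?_).2⟩
    · rw [rep1, ← pos_add]; apply pos_congr <;> omega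
    · rw [sing2, ← pos_add]; apply pos_congr <;> omega
  · right
    have h1 := count_of_rep hR
    rw [count_pos c k hc hk] at h1
    obtain rfl : i = 3 := by split_ifs at h1 <;> omega
    simp at h1
    obtain ⟨d', rfl⟩ : ∃ d', d = d' + (c + 1) := ⟨d - (c + 1), by omega⟩
    refine ⟨d', rfl, Eq.symm (move_eq (A' := pos c k a b d' e) ?_ ?_).2⟩
    · rw [rep3, ← pos_add]; apply pos_congr <;> omega
    · rw [sing4, ← pos_add]
      have : k ≠ 2 := by omega
      apply pos_congr <;> simp [dl, this]
  · right
    have h1 := count_of_rep hR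
    rw [count_pos c k hc hk] at h1
    obtain rfl : k = 2 := by split_ifs at h1 <;> omega
    simp at h1
    obtain ⟨d', rfl⟩ : ∃ d', d = d' + (c + 1) := ⟨d - (c + 1), by omega⟩
    refine ⟨d', rfl, Eq.symm (move_eq (A' := pos c 2 a b d' e) ?_ ?_).2⟩
    · rw [rep3, ← pos_add]; apply pos_congr <;> omega
    · rw [sing41, ← pos_add]
      apply pos_congr <;> simp [dl]
  · exfalso
    have h1 := count_of_rep hR
    rw [count_pos c k hc hk] at h1
    split_ifs at h1 <;> omega

/-! ### Strategy -/

theorem lose_forced (c k : ℕ) (hc : 1 ≤ c) (hk : 1 < k) {a b d : ℕ} (hb : b < c) (hd : d ≤ c)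
    (h : Out (CkMove c k) true (pos c k a (b + 1) d 0)) :
    Out (CkMove c k) false (pos c k (a + (c + 1)) b d 0) := by
  refine .lose _ fun B hB => ?_
  rcases move_inv c k hc hk hb (Nat.zero_le _) hB with ⟨a', h1, rfl⟩ | ⟨d', h1, rfl⟩
  · obtain rfl : a = a' := by omega
    exact h
  · omega

theorem win_two (c k : ℕ) (hc : 1 ≤ c) (hk : 1 < k) {a b d : ℕ} (hb : b + 2 ≤ c) (hd : d ≤ c)
    (h : Out (CkMove c k) true (pos c k a (b + 2) d 0)) :
    Out (CkMove c k) true (pos c k (a + 2 * (c + 1)) b d 0) := by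
  have h1 := lose_forced c k hc hk (b := b + 1) (by omega) hd h
  have h2 := Out.win _ _ (move_one c k (a + (c + 1)) b d 0) h1
  have : a + 2 * (c + 1) = a + (c + 1) + (c + 1) := by ring
  rwa [this]

theorem win_many (c k : ℕ) (hc : 1 ≤ c) (hk : 1 < k) {a d : ℕ} (hd : d ≤ c)
    (h : Out (CkMove c k) true (pos c k a c d 0)) (j b : ℕ) (hj : b + 2 * j = c) :
    Out (CkMove c k) true (pos c k (a + 2 * j * (c + 1)) b d 0) := by
  induction j generalizing b with
  | zero =>
    obtain rfl : b = c := by omega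
    simpa using h
  | succ j ih =>
    have h1 := win_two c k hc hk (b := b) (by omega) hd (ih (b + 2) (by omega))
    have : a + 2 * (j + 1) * (c + 1) = a + 2 * j * (c + 1) + 2 * (c + 1) := by ring
    rwa [this]

theorem lose_chain (c k : ℕ) (hc : 1 ≤ c) (hodd : Odd c) (hk : 1 < k) {a d : ℕ} (hd : d ≤ c)
    (h : Out (CkMove c k) true (pos c k a c d 0)) :
    Out (CkMove c k) false (pos c k (a + c * (c + 1)) 0 d 0) := by
  obtain ⟨j, hj⟩ := hodd
  have h1 := win_many c k hc hk hd h j 1 (by omega)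
  have h2 := lose_forced c k hc hk (b := 0) (by omega) hd h1
  have : a + c * (c + 1) = a + 2 * j * (c + 1) + (c + 1) := by
    have : c * (c + 1) = (2 * j + 1) * (c + 1) := by rw [← hj]
    rw [this]; ring
  rwa [this]

theorem win_top (c k : ℕ) (hc : 1 ≤ c) (hk : 1 < k) (a : ℕ) :
    Out (CkMove c k) true (pos c k (a + (c + 1) + (c + 1)) c c 0) := by
  rcases out_total c k hc hk _ (pos c k (a + (c + 1) + dl k) 0 0 1) rfl with hZ | hZ
  · have hZ1 : Out (CkMove c k) false (pos c k (a + dl k) 1 0 1) := by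
      cases hZ with
      | win _ B hB hO =>
        rcases move_inv c k hc hk (by omega) (by omega) hB with ⟨a', h1, rfl⟩ | ⟨d', h1, rfl⟩
        · obtain rfl : a' = a + dl k := by omega
          exact hO
        · omega
    have hT : Out (CkMove c k) true (pos c k a 1 (c + 1) 0) := by
      have := move_three c k a 1 0 0 hk
      rw [Nat.zero_add] at this
      exact .win _ _ this hZ1
    have hW : Out (CkMove c k) false (pos c k (a + (c + 1)) 0 (c + 1) 0) := by
      refine .lose _ fun B hB => ?_
      rcases move_inv c k hc hk (by omega) (by omega) hB with ⟨a', h1, rfl⟩ | ⟨d', h1, rfl⟩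
      · obtain rfl : a = a' := by omega
        exact hT
      · obtain rfl : d' = 0 := by omega
        exact hZ
    have := move_two c k (a + (c + 1)) 0 c 0 hk
    rw [Nat.zero_add] at this
    exact .win _ _ this hW
  · have := move_big c k (a + (c + 1)) 0 0 0 hk
    rw [Nat.zero_add] at this
    exact .win _ _ this hZ

theorem lose_main (c k : ℕ) (hc : 1 ≤ c) (hodd : Odd c) (hk : 1 < k) (s : ℕ) :
    ∀ a d : ℕ, d + s = c → (c + 1) ^ 3 + (c + 1) ≤ a + d * (c + 1) ^ 2 →
    Out (CkMove c k) false (pos c k a 0 d 0) := by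
  induction s with
  | zero =>
    intro a d hd ha
    obtain rfl : d = c := by omega
    obtain ⟨a', rfl⟩ : ∃ a', a = a' + (d + 1) + (d + 1) + d * (d + 1) :=
      ⟨a - ((d + 1) + (d + 1) + d * (d + 1)), by
        have : (d + 1) + (d + 1) + d * (d + 1) ≤ a := by nlinarith
        omega⟩
    exact lose_chain d k hc hodd hk le_rfl (win_top d k hc hk a')
  | succ s ih =>
    intro a d hd ha
    obtain ⟨a', rfl⟩ : ∃ a', a = a' + (c + 1) + c * (c + 1) :=
      ⟨a - ((c + 1) + c * (c + 1)), by
        have h1 : (d + 1) * (c + 1) ^ 2 ≤ (c + 1) * (c + 1) ^ 2 :=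
          Nat.mul_le_mul_right _ (by omega)
        have : (c + 1) + c * (c + 1) ≤ a := by nlinarith
        omega⟩
    apply lose_chain c k hc hodd hk (by omega)
    have h1 := move_two c k a' 0 d 0 hk
    rw [Nat.zero_add] at h1
    refine .win _ _ h1 (ih a' (d + 1) (by omega) ?_)
    nlinarith

theorem pos_start (c k n : ℕ) : pos c k n 0 0 0 = Multiset.replicate n 1 := by
  simp [pos, nacci_one]

end CkGame

open CkGame

/-- Let `c` be odd, `k > 1`, and `n ≥ (c+1)³ + (c+1)`.  Then Player 2 has a winning
strategy in the two-player `(c,k)`-nacci Zeckendorf game on `n`, but there exists a legal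
move for Player 2 on turn `c+1` (i.e., from the position reached after the first `c`
moves) after which Player 1 has a winning strategy for the remainder of the game. -/
theorem odd_c_player_two_wins_but_can_err (c k n : ℕ) (hc : 1 ≤ c) (hcodd : Odd c)
    (hk : 1 < k) (hn : (c + 1) ^ 3 + (c + 1) ≤ n) :
    PlayerWins (CkMove c k) 2 2 n ∧
    ∃ path : ℕ → Multiset ℕ,
      path 0 = Multiset.replicate n 1 ∧
      (∀ t, t < c → CkMove c k (path t) (path (t + 1))) ∧
      (∃ B, CkMove c k (path c) B ∧
        AllianceWins (CkMove c k) 2 (fun q => q = 1) (c + 1) B) := by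
  have hbig : (c + 1) * (c + 1) ≤ n := by nlinarith [sq_nonneg c]
  obtain ⟨a, rfl⟩ : ∃ a, n = a + (c + 1) * (c + 1) := ⟨n - (c + 1) * (c + 1), by omega⟩
  constructor
  · have h0 := lose_main c k hc hcodd hk c (a + (c + 1) * (c + 1)) 0 (by omega) (by omega)
    have hm := move_one c k (a + c * (c + 1)) 0 0 0
    have he : a + c * (c + 1) + (c + 1) = a + (c + 1) * (c + 1) := by ring
    rw [he, pos_start] at hm
    rw [pos_start] at h0
    rcases (h0.alliance (m := 2) (Or.inr rfl) 0).2 rfl (by omega) with h1 | h1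
    · exact absurd hm (h1 _)
    · exact h1
  · refine ⟨fun t => pos c k (a + (c + 1 - t) * (c + 1)) t 0 0, ?_, ?_, ?_⟩
    · simp only [Nat.sub_zero]
      rw [pos_start]
    · intro t ht
      obtain ⟨s, rfl⟩ : ∃ s, c = t + s := ⟨c - t, by omega⟩
      have h1 := move_one (t + s) k (a + s * (t + s + 1)) t 0 0
      have e1 : t + s + 1 - t = s + 1 := by omega
      have e2 : t + s + 1 - (t + 1) = s := by omega
      have e3 : a + (s + 1) * (t + s + 1) = a + s * (t + s + 1) + (t + s + 1) := by ring
      simp only [e1, e2, e3]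
      exact h1
    · refine ⟨pos c k a (c + 1) 0 0, ?_, ?_⟩
      · have h1 := move_one c k a c 0 0
        have e1 : c + 1 - c = 1 := by omega
        simp only [e1, one_mul]
        exact h1
      · have hX : Out (CkMove c k) false (pos c k a 0 1 0) := by
          refine lose_main c k hc hcodd hk (c - 1) a 1 (by omega) ?_
          nlinarith
        have hmv : CkMove c k (pos c k a (c + 1) 0 0) (pos c k a 0 1 0) := by
          right; right; right; left
          refine ⟨2, by omega, by omega, ?_⟩
          apply move_eq (A' := pos c k a 0 0 0)
          · rw [rep2, ← pos_add]; apply pos_congr <;> omega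
          · rw [sing3, ← pos_add]; apply pos_congr <;> omega
        have hB := Out.win _ _ hmv hX
        obtain ⟨j, hj⟩ := hcodd
        exact (hB.alliance (m := 1) (Or.inl rfl) (c + 1)).1 rfl (by omega)
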